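/- (Normal-form step in the proof of Lemma 2.) Let E_1, E_2, E_3, E_4 be the ℤ-linear automorphisms of ℤ^4 given by E_1(a,b,c,d) = (a−d, b, c+b, d), E_2(a,b,c,d) = (a, b−c, c, d+a), E_3(a,b,c,d) = (a, b−d, c+a, d), E_4(a,b,c,d) = (a+c, b, c, d−b). Then for every (a,b,c,d) ∈ ℤ^4 there exist an element φ of the subgroup of GL_4(ℤ) generated by E_1, E_2, E_3, E_4 and an integer b' such that φ(a,b,c,d) = (gcd(a,b,c,d), b', 0, 0). -/

import Mathlib

namespace MinGenusT2

/-- `ℤ⁴`, written as coordinates `(a, b, c, d)`. -/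
abbrev Z4 := ℤ × ℤ × ℤ × ℤ

/-- `E₁(a,b,c,d) = (a−d, b, c+b, d)`. -/
def E1 : Z4 → Z4 := fun p => (p.1 - p.2.2.2, p.2.1, p.2.2.1 + p.2.1, p.2.2.2)

/-- `E₂(a,b,c,d) = (a, b−c, c, d+a)`. -/
def E2 : Z4 → Z4 := fun p => (p.1, p.2.1 - p.2.2.1, p.2.2.1, p.2.2.2 + p.1)

/-- `E₃(a,b,c,d) = (a, b−d, c+a, d)`. -/
def E3 : Z4 → Z4 := fun p => (p.1, p.2.1 - p.2.2.2, p.2.2.1 + p.1, p.2.2.2)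

/-- `E₄(a,b,c,d) = (a+c, b, c, d−b)`. -/
def E4 : Z4 → Z4 := fun p => (p.1 + p.2.2.1, p.2.1, p.2.2.1, p.2.2.2 - p.2.1)

/-- The maps `E₁, E₂, E₃, E₄` as elements of `GL₄(ℤ)`, the group of ℤ-linear
automorphisms of `ℤ⁴`. -/
def eGens : Set (Z4 ≃ₗ[ℤ] Z4) :=
  {φ | ⇑φ = E1 ∨ ⇑φ = E2 ∨ ⇑φ = E3 ∨ ⇑φ = E4}

/-- The gcd of four integers (nonnegative, with `gcd4 0 0 0 0 = 0`). -/
def gcd4 (a b c d : ℤ) : ℤ := Int.gcd a (Int.gcd b (Int.gcd c d))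

/-- `w` lies in the orbit of `v` under the group generated by `E₁, E₂, E₃, E₄`. -/
def Reach (v w : Z4) : Prop := ∃ φ ∈ Subgroup.closure eGens, φ v = w

lemma Reach.refl (v : Z4) : Reach v v := ⟨1, one_mem _, rfl⟩

lemma Reach.trans {u v w : Z4} : Reach u v → Reach v w → Reach u w := by
  rintro ⟨φ, hφ, rfl⟩ ⟨ψ, hψ, rfl⟩
  exact ⟨ψ * φ, mul_mem hψ hφ, rfl⟩

lemma Reach.symm {v w : Z4} : Reach v w → Reach w v := by
  rintro ⟨φ, hφ, rfl⟩
  exact ⟨φ⁻¹, inv_mem hφ, φ.symm_apply_apply v⟩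

lemma reach_E1 (v : Z4) : Reach v (E1 v) := by
  let φ : Z4 ≃ₗ[ℤ] Z4 :=
    { toFun := E1
      invFun := fun p => (p.1 + p.2.2.2, p.2.1, p.2.2.1 - p.2.1, p.2.2.2)
      map_add' := fun x y => by ext <;> simp [E1] <;> ring
      map_smul' := fun r x => by ext <;> simp [E1] <;> ring
      left_inv := fun x => by ext <;> simp [E1]
      right_inv := fun x => by ext <;> simp [E1] }
  exact ⟨φ, Subgroup.subset_closure (Or.inl rfl), rfl⟩

lemma reach_E2 (v : Z4) : Reach v (E2 v) := by
  let φ : Z4 ≃ₗ[ℤ] Z4 :=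
    { toFun := E2
      invFun := fun p => (p.1, p.2.1 + p.2.2.1, p.2.2.1, p.2.2.2 - p.1)
      map_add' := fun x y => by ext <;> simp [E2] <;> ring
      map_smul' := fun r x => by ext <;> simp [E2] <;> ring
      left_inv := fun x => by ext <;> simp [E2]
      right_inv := fun x => by ext <;> simp [E2] }
  exact ⟨φ, Subgroup.subset_closure (Or.inr (Or.inl rfl)), rfl⟩

lemma reach_E3 (v : Z4) : Reach v (E3 v) := by
  let φ : Z4 ≃ₗ[ℤ] Z4 :=
    { toFun := E3
      invFun := fun p => (p.1, p.2.1 + p.2.2.2, p.2.2.1 - p.1, p.2.2.2)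
      map_add' := fun x y => by ext <;> simp [E3] <;> ring
      map_smul' := fun r x => by ext <;> simp [E3] <;> ring
      left_inv := fun x => by ext <;> simp [E3]
      right_inv := fun x => by ext <;> simp [E3] }
  exact ⟨φ, Subgroup.subset_closure (Or.inr (Or.inr (Or.inl rfl))), rfl⟩

lemma reach_E4 (v : Z4) : Reach v (E4 v) := by
  let φ : Z4 ≃ₗ[ℤ] Z4 :=
    { toFun := E4
      invFun := fun p => (p.1 - p.2.2.1, p.2.1, p.2.2.1, p.2.2.2 + p.2.1)
      map_add' := fun x y => by ext <;> simp [E4] <;> ring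
      map_smul' := fun r x => by ext <;> simp [E4] <;> ring
      left_inv := fun x => by ext <;> simp [E4]
      right_inv := fun x => by ext <;> simp [E4] }
  exact ⟨φ, Subgroup.subset_closure (Or.inr (Or.inr (Or.inr rfl))), rfl⟩

/-- The `k`-th power of `E₃`, for an integer `k`. -/
lemma reach_E3_zpow (a b c d k : ℤ) : Reach (a, b, c, d) (a, b - k * d, c + k * a, d) := by
  induction k using Int.induction_on with
  | zero => simpa using Reach.refl _
  | succ n ih =>
    convert ih.trans (reach_E3 _) using 1
    ext <;> simp [E3] <;> ring
  | pred n ih =>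
    refine ih.trans (Reach.symm ?_)
    convert reach_E3 _ using 1
    ext <;> simp [E3] <;> ring

/-- The `k`-th power of `E₂`, for an integer `k`. -/
lemma reach_E2_zpow (a b c d k : ℤ) : Reach (a, b, c, d) (a, b - k * c, c, d + k * a) := by
  induction k using Int.induction_on with
  | zero => simpa using Reach.refl _
  | succ n ih =>
    convert ih.trans (reach_E2 _) using 1
    ext <;> simp [E2] <;> ring
  | pred n ih =>
    refine ih.trans (Reach.symm ?_)
    convert reach_E2 _ using 1
    ext <;> simp [E2] <;> ring

/-- The swap of the rows of `!![a, -d; c, b]`, up to sign. -/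
lemma reach_swap_rows (a b c d : ℤ) : Reach (a, b, c, d) (c, d, -a, -b) := by
  have h := (reach_E4 (a, b, c, d)).trans
    ((reach_E3_zpow _ _ _ _ (-1)).trans (reach_E4 _))
  convert h using 1
  ext <;> simp [E4]

/-- The swap of the columns of `!![a, -d; c, b]`, up to sign. -/
lemma reach_swap_columns (a b c d : ℤ) : Reach (a, b, c, d) (-d, -c, b, a) := by
  have h := (reach_E1 (a, b, c, d)).trans ((reach_E2 _).trans (reach_E1 _))
  convert h using 1
  ext <;> simp [E1, E2]

lemma reach_neg (a b c d : ℤ) : Reach (a, b, c, d) (-a, -b, -c, -d) :=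
  (reach_swap_rows a b c d).trans (reach_swap_rows _ _ _ _)

lemma exists_reach_of_ne_zero (a b c d : ℤ) (ha : a ≠ 0) :
    ∃ a' b' : ℤ, 0 ≤ a' ∧ a' ∣ b' ∧ Reach (a, b, c, d) (a', b', 0, 0) := by
  induction hn : a.natAbs using Nat.strong_induction_on generalizing a b c d with
  | _ n ih =>
    have emod_lt (x : ℤ) : (x % a).natAbs < n := by
      have h₁ := Int.emod_nonneg x ha
      have h₂ := Int.emod_lt_abs x ha
      rw [Int.abs_eq_natAbs] at h₂
      omega
    have of_not_dvd_c (b c d : ℤ) (hc : ¬ a ∣ c) :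
        ∃ a' b' : ℤ, 0 ≤ a' ∧ a' ∣ b' ∧ Reach (a, b, c, d) (a', b', 0, 0) := by
      have h := (reach_E3_zpow a b c d (-(c / a))).trans (reach_swap_rows _ _ _ _)
      rw [show c + -(c / a) * a = c % a by rw [Int.emod_def]; ring] at h
      obtain ⟨a', b', h0, hdvd, h'⟩ := ih _ (emod_lt c) (c % a) _ _ _
        (fun h0 => hc (Int.dvd_of_emod_eq_zero h0)) rfl
      exact ⟨a', b', h0, hdvd, h.trans h'⟩
    by_cases hc : a ∣ c
    swap
    · exact of_not_dvd_c b c d hc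
    by_cases hd : a ∣ d
    swap
    · have h := (reach_E2_zpow a b c d (-(d / a))).trans (reach_swap_columns _ _ _ _)
      rw [show d + -(d / a) * a = d % a by rw [Int.emod_def]; ring] at h
      obtain ⟨a', b', h0, hdvd, h'⟩ := ih _ (by simpa using emod_lt d) (-(d % a)) _ _ _
        (fun h0 => hd (Int.dvd_of_emod_eq_zero (neg_eq_zero.mp h0))) rfl
      exact ⟨a', b', h0, hdvd, h.trans h'⟩
    obtain ⟨k, rfl⟩ := hc
    obtain ⟨l, rfl⟩ := hd
    have h := (reach_E3_zpow a b (a * k) (a * l) (-k)).trans (reach_E2_zpow _ _ _ _ (-l))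
    rw [show a * k + -k * a = 0 by ring, show a * l + -l * a = 0 by ring] at h
    generalize b - -k * (a * l) - -l * 0 = e at h
    by_cases he : a ∣ e
    · rcases le_total 0 a with h0 | h0
      · exact ⟨a, e, h0, he, h⟩
      · exact ⟨-a, -e, by omega, by simpa using he, h.trans (by simpa using reach_neg a e 0 0)⟩
    · obtain ⟨a', b', h0, hdvd, h'⟩ := of_not_dvd_c e e 0 he
      refine ⟨a', b', h0, hdvd, h.trans (Reach.trans ?_ h')⟩
      simpa [E1] using reach_E1 (a, e, 0, 0)

lemma exists_reach (a b c d : ℤ) :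
    ∃ a' b' : ℤ, 0 ≤ a' ∧ a' ∣ b' ∧ Reach (a, b, c, d) (a', b', 0, 0) := by
  have of_reach {p q r s : ℤ} (h : Reach (a, b, c, d) (p, q, r, s)) (hp : p ≠ 0) :
      ∃ a' b' : ℤ, 0 ≤ a' ∧ a' ∣ b' ∧ Reach (a, b, c, d) (a', b', 0, 0) := by
    obtain ⟨a', b', h0, hdvd, h'⟩ := exists_reach_of_ne_zero p q r s hp
    exact ⟨a', b', h0, hdvd, h.trans h'⟩
  by_cases ha : a = 0
  swap
  · exact of_reach (Reach.refl _) ha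
  by_cases hc : c = 0
  swap
  · exact of_reach (reach_swap_rows a b c d) hc
  by_cases hd : d = 0
  swap
  · exact of_reach (reach_swap_columns a b c d) (neg_ne_zero.mpr hd)
  by_cases hb : b = 0
  swap
  · exact of_reach ((reach_swap_rows a b c d).trans (reach_swap_columns _ _ _ _))
      (by simpa using hb)
  subst ha hb hc hd
  exact ⟨0, 0, le_rfl, dvd_rfl, Reach.refl _⟩

/-- Common divisors of the coordinates are preserved along orbits. -/
lemma Reach.dvd {n a b c d a' b' c' d' : ℤ} (h : Reach (a, b, c, d) (a', b', c', d'))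
    (ha : n ∣ a) (hb : n ∣ b) (hc : n ∣ c) (hd : n ∣ d) :
    n ∣ a' ∧ n ∣ b' ∧ n ∣ c' ∧ n ∣ d' := by
  obtain ⟨φ, -, hφ⟩ := h
  obtain ⟨a, rfl⟩ := ha
  obtain ⟨b, rfl⟩ := hb
  obtain ⟨c, rfl⟩ := hc
  obtain ⟨d, rfl⟩ := hd
  have key : φ (n * a, n * b, n * c, n * d) = n • φ (a, b, c, d) := by
    rw [← map_smul]
    simp
  rw [hφ] at key
  simp only [Prod.ext_iff, Prod.smul_fst, Prod.smul_snd, smul_eq_mul] at key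
  exact ⟨⟨_, key.1⟩, ⟨_, key.2.1⟩, ⟨_, key.2.2.1⟩, ⟨_, key.2.2.2⟩⟩

lemma dvd_gcd4_iff {n a b c d : ℤ} :
    n ∣ gcd4 a b c d ↔ n ∣ a ∧ n ∣ b ∧ n ∣ c ∧ n ∣ d := by
  simp [gcd4, Int.dvd_coe_gcd_iff]

/-- normal-form step in the proof of Lemma 2: every `(a,b,c,d) ∈ ℤ⁴`
can be moved by an element of the subgroup of `GL₄(ℤ)` generated by `E₁, E₂, E₃, E₄`
to `(gcd(a,b,c,d), b', 0, 0)` for some integer `b'`. -/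
theorem statement4 (v : Z4) :
    ∃ φ ∈ Subgroup.closure eGens, ∃ b' : ℤ,
      φ v = (gcd4 v.1 v.2.1 v.2.2.1 v.2.2.2, b', 0, 0) := by
  obtain ⟨a, b, c, d⟩ := v
  obtain ⟨a', b', h0, hdvd, h⟩ := exists_reach a b c d
  have hgcd : gcd4 a b c d = a' := by
    refine Int.dvd_antisymm (Int.natCast_nonneg _) h0 ?_ ?_
    · obtain ⟨ha, hb, hc, hd⟩ := dvd_gcd4_iff.mp (dvd_refl (gcd4 a b c d))
      exact (h.dvd ha hb hc hd).1
    · exact dvd_gcd4_iff.mpr (h.symm.dvd dvd_rfl hdvd (dvd_zero _) (dvd_zero _))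
  obtain ⟨φ, hφ, hv⟩ := h
  exact ⟨φ, hφ, b', by rw [hv, hgcd]⟩

end MinGenusT2
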